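/- arXiv:0803.3480 — 4 statements merged into one kernel-verified Lean document; each statement's English description precedes it below -/
import Mathlib

section
/- Let Ω ⊆ H be an open set disjoint from the real axis and let f = u + ιv be a complex-like, ℝ-differentiable function on Ω. For (t,r,α,β) with r > 0, sin β ≠ 0 and t + r·ι(α,β) ∈ Ω, set U(t,r,α,β) = u(t + r·ι(α,β)) and V(t,r,α,β) = v(t + r·ι(α,β)). Then f is hyperholomorphic on Ω if and only if at every such point the following four equations hold: ∂U/∂t − ∂V/∂r = 0, ∂V/∂t + ∂U/∂r = 0, (sin β)⁻¹·∂V/∂α + ∂U/∂β = 0, and (sin β)⁻¹·∂U/∂α − ∂V/∂β = 0. -/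
open Quaternion MeasureTheory

noncomputable section

/-- `r(p)` : distance from the real axis. -/
def rr (p : ℍ[ℝ]) : ℝ := Real.sqrt (p.imI ^ 2 + p.imJ ^ 2 + p.imK ^ 2)

def qi : ℍ[ℝ] := ⟨0, 1, 0, 0⟩
def qj : ℍ[ℝ] := ⟨0, 0, 1, 0⟩
def qk : ℍ[ℝ] := ⟨0, 0, 0, 1⟩

/-- imaginary part of a quaternion -/
def qim (p : ℍ[ℝ]) : ℍ[ℝ] := ⟨0, p.imI, p.imJ, p.imK⟩

/-- `ι(p)` -/
def iota (p : ℍ[ℝ]) : ℍ[ℝ] := (rr p)⁻¹ • qim p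

/-- left Fueter operator -/
def Dl (f : ℍ[ℝ] → ℍ[ℝ]) (p : ℍ[ℝ]) : ℍ[ℝ] :=
  fderiv ℝ f p 1 + qi * fderiv ℝ f p qi + qj * fderiv ℝ f p qj + qk * fderiv ℝ f p qk

/-- right Fueter operator -/
def Dr (f : ℍ[ℝ] → ℍ[ℝ]) (p : ℍ[ℝ]) : ℍ[ℝ] :=
  fderiv ℝ f p 1 + fderiv ℝ f p qi * qi + fderiv ℝ f p qj * qj + fderiv ℝ f p qk * qk

/-- hyperholomorphic on `Ω` with decomposition `f = u + ι v` -/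
def Hyperholo (Ω : Set ℍ[ℝ]) (f : ℍ[ℝ] → ℍ[ℝ]) (u v : ℍ[ℝ] → ℝ) : Prop :=
  (∀ p ∈ Ω, DifferentiableAt ℝ f p) ∧
  (∀ p ∈ Ω, f p = (u p : ℍ[ℝ]) + iota p * (v p : ℍ[ℝ])) ∧
  (∀ p ∈ Ω, Dl f p = ((-2 * v p / rr p : ℝ) : ℍ[ℝ]))

/-- spherical parametrization of the imaginary unit sphere -/
def iotaSph (α β : ℝ) : ℍ[ℝ] :=
  ⟨0, Real.cos α * Real.sin β, Real.sin α * Real.sin β, Real.cos β⟩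

/-- the point `t + r·ι(α,β)` -/
def pt (t r α β : ℝ) : ℍ[ℝ] := (t : ℍ[ℝ]) + (r : ℍ[ℝ]) * iotaSph α β


@[simp] theorem qi_re : qi.re = 0 := rfl
@[simp] theorem qi_imI : qi.imI = 1 := rfl
@[simp] theorem qi_imJ : qi.imJ = 0 := rfl
@[simp] theorem qi_imK : qi.imK = 0 := rfl
@[simp] theorem qj_re : qj.re = 0 := rfl
@[simp] theorem qj_imI : qj.imI = 0 := rfl
@[simp] theorem qj_imJ : qj.imJ = 1 := rfl
@[simp] theorem qj_imK : qj.imK = 0 := rfl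
@[simp] theorem qk_re : qk.re = 0 := rfl
@[simp] theorem qk_imI : qk.imI = 0 := rfl
@[simp] theorem qk_imJ : qk.imJ = 0 := rfl
@[simp] theorem qk_imK : qk.imK = 1 := rfl

@[simp] theorem qim_imI (p : ℍ[ℝ]) : (qim p).imI = p.imI := rfl
@[simp] theorem qim_imJ (p : ℍ[ℝ]) : (qim p).imJ = p.imJ := rfl
@[simp] theorem qim_imK (p : ℍ[ℝ]) : (qim p).imK = p.imK := rfl
@[simp] theorem qim_re (p : ℍ[ℝ]) : (qim p).re = 0 := rfl

/-- The quaternion with prescribed real coordinates. -/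
def qmk (a b c d : ℝ) : ℍ[ℝ] := ⟨a, b, c, d⟩

@[simp] theorem qmk_re (a b c d : ℝ) : (qmk a b c d).re = a := rfl
@[simp] theorem qmk_imI (a b c d : ℝ) : (qmk a b c d).imI = b := rfl
@[simp] theorem qmk_imJ (a b c d : ℝ) : (qmk a b c d).imJ = c := rfl
@[simp] theorem qmk_imK (a b c d : ℝ) : (qmk a b c d).imK = d := rfl

theorem quaternion_eq_smul_add (p : ℍ[ℝ]) :
    p = p.re • (1 : ℍ[ℝ]) + p.imI • qi + p.imJ • qj + p.imK • qk := by
  ext <;> simp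

theorem clm_apply_eq {F : Type*} [NormedAddCommGroup F] [NormedSpace ℝ F]
    (L : ℍ[ℝ] →L[ℝ] F) (p : ℍ[ℝ]) :
    L p = p.re • L 1 + p.imI • L qi + p.imJ • L qj + p.imK • L qk := by
  conv_lhs => rw [quaternion_eq_smul_add p]
  simp

theorem qmk_eq (a b c d : ℝ) :
    qmk a b c d = a • (1 : ℍ[ℝ]) + b • qi + c • qj + d • qk :=
  quaternion_eq_smul_add _

theorem hasDerivAt_quaternion_mk {a b c d : ℝ → ℝ} {a' b' c' d' s : ℝ}
    (ha : HasDerivAt a a' s) (hb : HasDerivAt b b' s) (hc : HasDerivAt c c' s)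
    (hd : HasDerivAt d d' s) :
    HasDerivAt (fun x => qmk (a x) (b x) (c x) (d x)) (qmk a' b' c' d') s := by
  have h := (((ha.smul_const (1 : ℍ[ℝ])).add (hb.smul_const qi)).add (hc.smul_const qj)).add
    (hd.smul_const qk)
  simp only [qmk_eq]
  exact h

theorem differentiableAt_quaternion_mk {E : Type*} [NormedAddCommGroup E] [NormedSpace ℝ E]
    {a b c d : E → ℝ} {x : E} (ha : DifferentiableAt ℝ a x) (hb : DifferentiableAt ℝ b x)
    (hc : DifferentiableAt ℝ c x) (hd : DifferentiableAt ℝ d x) :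
    DifferentiableAt ℝ (fun y => qmk (a y) (b y) (c y) (d y)) x := by
  have h := (((ha.smul_const (1 : ℍ[ℝ])).add (hb.smul_const qi)).add (hc.smul_const qj)).add
    (hd.smul_const qk)
  simp only [qmk_eq]
  exact h

/-- The four coordinates of a quaternion as a continuous linear map. -/
def coordCLM : ℍ[ℝ] →L[ℝ] ℝ × ℝ × ℝ × ℝ :=
  LinearMap.toContinuousLinearMap
    { toFun := fun p => (p.re, p.imI, p.imJ, p.imK)
      map_add' := fun p q => by simp
      map_smul' := fun c p => by simp }

def reCLM : ℍ[ℝ] →L[ℝ] ℝ := (ContinuousLinearMap.fst ℝ _ _).comp coordCLM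
def imICLM : ℍ[ℝ] →L[ℝ] ℝ :=
  (ContinuousLinearMap.fst ℝ _ _).comp ((ContinuousLinearMap.snd ℝ _ _).comp coordCLM)
def imJCLM : ℍ[ℝ] →L[ℝ] ℝ :=
  (ContinuousLinearMap.fst ℝ _ _).comp ((ContinuousLinearMap.snd ℝ _ _).comp
    ((ContinuousLinearMap.snd ℝ _ _).comp coordCLM))
def imKCLM : ℍ[ℝ] →L[ℝ] ℝ :=
  (ContinuousLinearMap.snd ℝ _ _).comp ((ContinuousLinearMap.snd ℝ _ _).comp
    ((ContinuousLinearMap.snd ℝ _ _).comp coordCLM))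

theorem reCLM_apply (p : ℍ[ℝ]) : reCLM p = p.re := rfl
theorem imICLM_apply (p : ℍ[ℝ]) : imICLM p = p.imI := rfl
theorem imJCLM_apply (p : ℍ[ℝ]) : imJCLM p = p.imJ := rfl
theorem imKCLM_apply (p : ℍ[ℝ]) : imKCLM p = p.imK := rfl

theorem rr_sq (p : ℍ[ℝ]) : rr p ^ 2 = p.imI ^ 2 + p.imJ ^ 2 + p.imK ^ 2 :=
  Real.sq_sqrt (by positivity)

theorem rr_pos {p : ℍ[ℝ]} (hp : qim p ≠ 0) : 0 < rr p := by
  refine Real.sqrt_pos.2 ?_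
  by_contra! h
  refine hp ?_
  have h1 : p.imI = 0 := by nlinarith [sq_nonneg p.imI, sq_nonneg p.imJ, sq_nonneg p.imK]
  have h2 : p.imJ = 0 := by nlinarith [sq_nonneg p.imI, sq_nonneg p.imJ, sq_nonneg p.imK]
  have h3 : p.imK = 0 := by nlinarith [sq_nonneg p.imI, sq_nonneg p.imJ, sq_nonneg p.imK]
  ext <;> simp [h1, h2, h3]

theorem hasFDerivAt_rr {p : ℍ[ℝ]} (hp : qim p ≠ 0) :
    HasFDerivAt rr ((rr p)⁻¹ • (p.imI • imICLM + p.imJ • imJCLM + p.imK • imKCLM)) p := by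
  have hI : HasFDerivAt (fun q : ℍ[ℝ] => q.imI) imICLM p := imICLM.hasFDerivAt
  have hJ : HasFDerivAt (fun q : ℍ[ℝ] => q.imJ) imJCLM p := imJCLM.hasFDerivAt
  have hK : HasFDerivAt (fun q : ℍ[ℝ] => q.imK) imKCLM p := imKCLM.hasFDerivAt
  have hr := rr_pos hp
  have hne : p.imI ^ 2 + p.imJ ^ 2 + p.imK ^ 2 ≠ 0 := by
    rw [← rr_sq]; positivity
  have h := (((hI.pow 2).add (hJ.pow 2)).add (hK.pow 2)).sqrt hne
  refine h.congr_fderiv ?_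
  have e : √(p.imI ^ 2 + p.imJ ^ 2 + p.imK ^ 2) = rr p := rfl
  ext q
  simp [e]
  field_simp

/-- The Cauchy-Riemann-Fueter system for `u + ι v` at `p`, in Cartesian coordinates. -/
def CauchyRiemannAt (u v : ℍ[ℝ] → ℝ) (p : ℍ[ℝ]) : Prop :=
  rr p * fderiv ℝ u p 1 =
      p.imI * fderiv ℝ v p qi + p.imJ * fderiv ℝ v p qj + p.imK * fderiv ℝ v p qk ∧
  rr p * fderiv ℝ u p qi + p.imI * fderiv ℝ v p 1
      + (p.imK * fderiv ℝ v p qj - p.imJ * fderiv ℝ v p qk) = 0 ∧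
  rr p * fderiv ℝ u p qj + p.imJ * fderiv ℝ v p 1
      + (p.imI * fderiv ℝ v p qk - p.imK * fderiv ℝ v p qi) = 0 ∧
  rr p * fderiv ℝ u p qk + p.imK * fderiv ℝ v p 1
      + (p.imJ * fderiv ℝ v p qi - p.imI * fderiv ℝ v p qj) = 0

theorem complexLike_eq_mk {f : ℍ[ℝ] → ℍ[ℝ]} {u v : ℍ[ℝ] → ℝ} {p : ℍ[ℝ]}
    (h : f p = (u p : ℍ[ℝ]) + iota p * (v p : ℍ[ℝ])) :
    f p = qmk (u p) ((rr p)⁻¹ * v p * p.imI) ((rr p)⁻¹ * v p * p.imJ) ((rr p)⁻¹ * v p * p.imK) := by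
  rw [h]; ext <;> simp [iota] <;> ring

theorem differentiableAt_of_complexLike {f : ℍ[ℝ] → ℍ[ℝ]} {u v : ℍ[ℝ] → ℝ} {p : ℍ[ℝ]}
    (hp : qim p ≠ 0) (hax : ∀ᶠ q in nhds p, qim q ≠ 0)
    (hcl : ∀ᶠ q in nhds p, f q = (u q : ℍ[ℝ]) + iota q * (v q : ℍ[ℝ]))
    (hf : DifferentiableAt ℝ f p) :
    DifferentiableAt ℝ u p ∧ DifferentiableAt ℝ v p := by
  have hr := (hasFDerivAt_rr hp).differentiableAt
  have hr0 := rr_pos hp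
  have hre : DifferentiableAt ℝ (fun q => (f q).re) p := reCLM.differentiableAt.comp p hf
  have hI : DifferentiableAt ℝ (fun q => (f q).imI) p := imICLM.differentiableAt.comp p hf
  have hJ : DifferentiableAt ℝ (fun q => (f q).imJ) p := imJCLM.differentiableAt.comp p hf
  have hK : DifferentiableAt ℝ (fun q => (f q).imK) p := imKCLM.differentiableAt.comp p hf
  have hI' : DifferentiableAt ℝ (fun q : ℍ[ℝ] => q.imI) p := imICLM.differentiableAt
  have hJ' : DifferentiableAt ℝ (fun q : ℍ[ℝ] => q.imJ) p := imJCLM.differentiableAt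
  have hK' : DifferentiableAt ℝ (fun q : ℍ[ℝ] => q.imK) p := imKCLM.differentiableAt
  constructor
  · refine hre.congr_of_eventuallyEq ?_
    filter_upwards [hcl] with q hq
    rw [complexLike_eq_mk hq, qmk_re]
  · have h : DifferentiableAt ℝ (fun q => (rr q)⁻¹ *
        ((f q).imI * q.imI + (f q).imJ * q.imJ + (f q).imK * q.imK)) p :=
      (hr.inv hr0.ne').mul (((hI.mul hI').add (hJ.mul hJ')).add (hK.mul hK'))
    refine h.congr_of_eventuallyEq ?_
    filter_upwards [hcl, hax] with q hq hq0
    rw [complexLike_eq_mk hq]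
    have := rr_pos hq0
    have h2 := rr_sq q
    simp only [qmk_imI, qmk_imJ, qmk_imK]
    field_simp
    linear_combination (v q) * h2

theorem Dl_eq_iff_cauchyRiemannAt {f : ℍ[ℝ] → ℍ[ℝ]} {u v : ℍ[ℝ] → ℝ} {p : ℍ[ℝ]}
    (hp : qim p ≠ 0)
    (hcl : ∀ᶠ q in nhds p, f q = (u q : ℍ[ℝ]) + iota q * (v q : ℍ[ℝ]))
    (hu : DifferentiableAt ℝ u p) (hv : DifferentiableAt ℝ v p) :
    Dl f p = ((-2 * v p / rr p : ℝ) : ℍ[ℝ]) ↔ CauchyRiemannAt u v p := by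
  have hr := hasFDerivAt_rr hp
  have hr0 := rr_pos hp
  have hr2 := rr_sq p
  have hI : HasFDerivAt (fun q : ℍ[ℝ] => q.imI) imICLM p := imICLM.hasFDerivAt
  have hJ : HasFDerivAt (fun q : ℍ[ℝ] => q.imJ) imJCLM p := imJCLM.hasFDerivAt
  have hK : HasFDerivAt (fun q : ℍ[ℝ] => q.imK) imKCLM p := imKCLM.hasFDerivAt
  have hw := ((hasDerivAt_inv hr0.ne').comp_hasFDerivAt p hr).mul hv.hasFDerivAt
  have hF := (((hu.hasFDerivAt.smul_const (1 : ℍ[ℝ])).add ((hw.mul hI).smul_const qi)).add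
    ((hw.mul hJ).smul_const qj)).add ((hw.mul hK).smul_const qk)
  have hf := hF.congr_of_eventuallyEq (f₁ := f) (by
    filter_upwards [hcl] with q hq
    rw [complexLike_eq_mk hq]
    ext <;> simp)
  rw [Dl, hf.fderiv, CauchyRiemannAt, Quaternion.ext_iff]
  generalize hc : -2 * v p / rr p = c
  simp [imICLM_apply, imJCLM_apply, imKCLM_apply]
  generalize fderiv ℝ u p 1 = ut, fderiv ℝ u p qi = ui, fderiv ℝ u p qj = uj,
    fderiv ℝ u p qk = uk, fderiv ℝ v p 1 = vt, fderiv ℝ v p qi = vi, fderiv ℝ v p qj = vj,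
    fderiv ℝ v p qk = vk, p.imI = x, p.imJ = y, p.imK = z, rr p = r, v p = w at *
  subst hc
  have key {A B C D : ℝ} (h : (A - B) * r = C - D) : A = B ↔ C = D := by
    rw [← sub_eq_zero, ← sub_eq_zero (a := C), ← h, mul_eq_zero, or_iff_left hr0.ne']
  refine and_congr (key ?_) (and_congr (key ?_) (and_congr (key ?_) (key ?_)))
  · field_simp
    linear_combination (-w) * hr2
  all_goals
    field_simp
    ring


theorem pt_eq (t r α β : ℝ) :
    pt t r α β = qmk t (r * (Real.cos α * Real.sin β)) (r * (Real.sin α * Real.sin β))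
      (r * Real.cos β) := by
  rw [pt, show iotaSph α β = qmk 0 (Real.cos α * Real.sin β) (Real.sin α * Real.sin β)
    (Real.cos β) from rfl]
  ext <;> simp

theorem rr_pt {r : ℝ} (hr : 0 < r) (t α β : ℝ) : rr (pt t r α β) = r := by
  rw [← sq_eq_sq₀ (show 0 ≤ rr (pt t r α β) from Real.sqrt_nonneg _) hr.le, rr_sq,
    pt_eq]
  simp only [qmk_imI, qmk_imJ, qmk_imK]
  have h1 := Real.sin_sq_add_cos_sq α
  have h2 := Real.sin_sq_add_cos_sq β
  linear_combination (r ^ 2 * Real.sin β ^ 2) * h1 + r ^ 2 * h2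

/-- The Cauchy-Riemann equations of `u + ι v` in spherical coordinates. -/
def SphericalCauchyRiemannAt (u v : ℍ[ℝ] → ℝ) (t r α β : ℝ) : Prop :=
  deriv (fun s => u (pt s r α β)) t - deriv (fun s => v (pt t s α β)) r = 0 ∧
  deriv (fun s => v (pt s r α β)) t + deriv (fun s => u (pt t s α β)) r = 0 ∧
  (Real.sin β)⁻¹ * deriv (fun s => v (pt t r s β)) α + deriv (fun s => u (pt t r α s)) β = 0 ∧
  (Real.sin β)⁻¹ * deriv (fun s => u (pt t r s β)) α - deriv (fun s => v (pt t r α s)) β = 0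

theorem deriv_pt {u : ℍ[ℝ] → ℝ} {t r α β : ℝ} (hu : DifferentiableAt ℝ u (pt t r α β)) :
    deriv (fun s => u (pt s r α β)) t = fderiv ℝ u (pt t r α β) (qmk 1 0 0 0) ∧
    deriv (fun s => u (pt t s α β)) r = fderiv ℝ u (pt t r α β)
      (qmk 0 (Real.cos α * Real.sin β) (Real.sin α * Real.sin β) (Real.cos β)) ∧
    deriv (fun s => u (pt t r s β)) α = fderiv ℝ u (pt t r α β)
      (qmk 0 (r * (-Real.sin α * Real.sin β)) (r * (Real.cos α * Real.sin β)) 0) ∧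
    deriv (fun s => u (pt t r α s)) β = fderiv ℝ u (pt t r α β)
      (qmk 0 (r * (Real.cos α * Real.cos β)) (r * (Real.sin α * Real.cos β))
        (r * -Real.sin β)) := by
  have hsα := Real.hasDerivAt_sin α
  have hcα := Real.hasDerivAt_cos α
  have hsβ := Real.hasDerivAt_sin β
  have hcβ := Real.hasDerivAt_cos β
  have hr := hasDerivAt_id' r
  refine ⟨?_, ?_, ?_, ?_⟩
  · have h : HasDerivAt (fun s => pt s r α β) (qmk 1 0 0 0) t := by
      simp only [pt_eq]
      exact hasDerivAt_quaternion_mk (hasDerivAt_id' t) (hasDerivAt_const _ _)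
        (hasDerivAt_const _ _) (hasDerivAt_const _ _)
    exact (hu.hasFDerivAt.comp_hasDerivAt t h).deriv
  · have h : HasDerivAt (fun s => pt t s α β)
        (qmk 0 (Real.cos α * Real.sin β) (Real.sin α * Real.sin β) (Real.cos β)) r := by
      simp only [pt_eq]
      refine hasDerivAt_quaternion_mk (hasDerivAt_const _ _) ?_ ?_ ?_
      · simpa using hr.mul_const (Real.cos α * Real.sin β)
      · simpa using hr.mul_const (Real.sin α * Real.sin β)
      · simpa using hr.mul_const (Real.cos β)
    exact (hu.hasFDerivAt.comp_hasDerivAt r h).deriv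
  · have h : HasDerivAt (fun s => pt t r s β)
        (qmk 0 (r * (-Real.sin α * Real.sin β)) (r * (Real.cos α * Real.sin β)) 0) α := by
      simp only [pt_eq]
      exact hasDerivAt_quaternion_mk (hasDerivAt_const _ _) ((hcα.mul_const _).const_mul r)
        ((hsα.mul_const _).const_mul r) (hasDerivAt_const _ _)
    exact (hu.hasFDerivAt.comp_hasDerivAt α h).deriv
  · have h : HasDerivAt (fun s => pt t r α s)
        (qmk 0 (r * (Real.cos α * Real.cos β)) (r * (Real.sin α * Real.cos β))
          (r * -Real.sin β)) β := by
      simp only [pt_eq]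
      exact hasDerivAt_quaternion_mk (hasDerivAt_const _ _) ((hsβ.const_mul _).const_mul r)
        ((hsβ.const_mul _).const_mul r) (hcβ.const_mul r)
    exact (hu.hasFDerivAt.comp_hasDerivAt β h).deriv

theorem cauchyRiemannAt_pt_iff {u v : ℍ[ℝ] → ℝ} {t r α β : ℝ} (hr : 0 < r)
    (hβ : Real.sin β ≠ 0) (hu : DifferentiableAt ℝ u (pt t r α β))
    (hv : DifferentiableAt ℝ v (pt t r α β)) :
    CauchyRiemannAt u v (pt t r α β) ↔ SphericalCauchyRiemannAt u v t r α β := by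
  obtain ⟨u1, u2, u3, u4⟩ := deriv_pt hu
  obtain ⟨v1, v2, v3, v4⟩ := deriv_pt hv
  rw [CauchyRiemannAt, SphericalCauchyRiemannAt, u1, u2, u3, u4, v1, v2, v3, v4, rr_pt hr]
  have h1 := Real.sin_sq_add_cos_sq α
  have h2 := Real.sin_sq_add_cos_sq β
  simp only [clm_apply_eq _ (qmk _ _ _ _), qmk_re, qmk_imI, qmk_imJ, qmk_imK, smul_eq_mul]
  have e1 : (pt t r α β).imI = r * (Real.cos α * Real.sin β) := by rw [pt_eq, qmk_imI]
  have e2 : (pt t r α β).imJ = r * (Real.sin α * Real.sin β) := by rw [pt_eq, qmk_imJ]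
  have e3 : (pt t r α β).imK = r * Real.cos β := by rw [pt_eq, qmk_imK]
  rw [e1, e2, e3]
  generalize fderiv ℝ u (pt t r α β) 1 = ut, fderiv ℝ u (pt t r α β) qi = ui,
    fderiv ℝ u (pt t r α β) qj = uj, fderiv ℝ u (pt t r α β) qk = uk,
    fderiv ℝ v (pt t r α β) 1 = vt, fderiv ℝ v (pt t r α β) qi = vi,
    fderiv ℝ v (pt t r α β) qj = vj, fderiv ℝ v (pt t r α β) qk = vk,
    Real.cos α = c, Real.sin α = s, Real.cos β = C, Real.sin β = S at *
  have hr' := hr.ne'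
  have hS : S⁻¹ * S = 1 := inv_mul_cancel₀ hβ
  constructor
  · rintro ⟨a0, a1, a2, a3⟩
    replace a0 : ut = c * S * vi + s * S * vj + C * vk := by
      apply mul_left_cancel₀ hr'; linear_combination a0
    replace a1 : ui + c * S * vt + (C * vj - s * S * vk) = 0 := by
      apply mul_left_cancel₀ hr'; linear_combination a1
    replace a2 : uj + s * S * vt + (c * S * vk - C * vi) = 0 := by
      apply mul_left_cancel₀ hr'; linear_combination a2
    replace a3 : uk + C * vt + (s * S * vi - c * S * vj) = 0 := by
      apply mul_left_cancel₀ hr'; linear_combination a3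
    refine ⟨?_, ?_, ?_, ?_⟩
    · linear_combination a0
    · linear_combination c * S * a1 + s * S * a2 + C * a3 - (S ^ 2 * vt) * h1 - vt * h2
    · linear_combination r * c * C * a1 + r * s * C * a2 - r * S * a3
        + r * (-s * vi + c * vj) * hS - r * C * S * vt * h1 - r * (c * vj - s * vi) * h2
    · linear_combination -r * s * a1 + r * c * a2 + r * (-s * ui + c * uj) * hS - r * S * vk * h1
  · rintro ⟨b0, b1, b2, b3⟩
    refine ⟨?_, ?_, ?_, ?_⟩
    · linear_combination r * b0
    · linear_combination r * c * S * b1 + c * C * b2 - s * b3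
        - r * (ui * c ^ 2 + uj * c * s) * h2 - r * (ui + C * vj) * h1
        - r * (c * C * (-s * vi + c * vj) - s * (-s * ui + c * uj)) * hS
    · linear_combination r * s * S * b1 + s * C * b2 + c * b3
        - r * (ui * c * s + uj * s ^ 2) * h2 - r * (uj - C * vi) * h1
        - r * (s * C * (-s * vi + c * vj) + c * (-s * ui + c * uj)) * hS
    · linear_combination r * C * b1 - S * b2 - r * uk * h2
        + r * S * (-s * vi + c * vj) * hS

theorem exists_pt_eq {p : ℍ[ℝ]} (hp : p.imI ≠ 0 ∨ p.imJ ≠ 0) :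
    ∃ t r α β : ℝ, 0 < r ∧ Real.sin β ≠ 0 ∧ pt t r α β = p := by
  set w : ℂ := ⟨p.imI, p.imJ⟩ with hw
  have hw0 : w ≠ 0 := by
    intro h
    have h1 := congrArg Complex.re h
    have h2 := congrArg Complex.im h
    simp [hw] at h1 h2
    tauto
  set z : ℂ := ⟨p.imK, ‖w‖⟩ with hz
  have hn : 0 < ‖w‖ := norm_pos_iff.2 hw0
  have hz0 : z ≠ 0 := by
    intro h
    have h2 := congrArg Complex.im h
    simp [hz] at h2
    exact hw0 h2
  have hzn : 0 < ‖z‖ := norm_pos_iff.2 hz0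
  have hs : ‖z‖ * Real.sin z.arg = ‖w‖ := Complex.norm_mul_sin_arg z
  have hc : ‖z‖ * Real.cos z.arg = p.imK := Complex.norm_mul_cos_arg z
  have hws : ‖w‖ * Real.sin w.arg = p.imJ := Complex.norm_mul_sin_arg w
  have hwc : ‖w‖ * Real.cos w.arg = p.imI := Complex.norm_mul_cos_arg w
  refine ⟨p.re, ‖z‖, w.arg, z.arg, hzn, fun h => ?_, ?_⟩
  · rw [h, mul_zero] at hs
    exact hn.ne hs
  · rw [pt_eq]
    ext
    · rfl
    · simp only [qmk_imI]; rw [← hwc, ← hs]; ring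
    · simp only [qmk_imJ]; rw [← hws, ← hs]; ring
    · simp only [qmk_imK]; exact hc

theorem differentiableAt_complex_comp_iff {u v : ℍ[ℝ] → ℝ} {P : ℂ → ℍ[ℝ]} {w : ℂ}
    {X Y : ℍ[ℝ]} (hu : DifferentiableAt ℝ u (P w)) (hv : DifferentiableAt ℝ v (P w))
    (hP : DifferentiableAt ℝ P w)
    (hX : HasDerivAt (fun s : ℝ => P (w + s)) X 0)
    (hY : HasDerivAt (fun s : ℝ => P (w + s * Complex.I)) Y 0) :
    DifferentiableAt ℂ (fun z => (u (P z) : ℂ) + v (P z) * Complex.I) w ↔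
      fderiv ℝ u (P w) X = fderiv ℝ v (P w) Y ∧
        fderiv ℝ u (P w) Y = -fderiv ℝ v (P w) X := by
  have hX' : fderiv ℝ P w 1 = X := by
    have h : HasDerivAt (fun s : ℝ => w + s) 1 (0 : ℝ) := by
      simpa using (Complex.ofRealCLM.hasDerivAt (x := (0 : ℝ))).const_add w
    have hP' : HasFDerivAt P (fderiv ℝ P w) (w + (0 : ℝ)) := by simpa using hP.hasFDerivAt
    exact (hP'.comp_hasDerivAt 0 h).unique hX
  have hY' : fderiv ℝ P w Complex.I = Y := by
    have h : HasDerivAt (fun s : ℝ => w + s * Complex.I) Complex.I (0 : ℝ) := by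
      simpa using
        ((Complex.ofRealCLM.hasDerivAt (x := (0 : ℝ))).mul_const Complex.I).const_add w
    have hP' : HasFDerivAt P (fderiv ℝ P w) (w + (0 : ℝ) * Complex.I) := by
      simpa using hP.hasFDerivAt
    exact (hP'.comp_hasDerivAt 0 h).unique hY
  have hU := hu.hasFDerivAt.comp w hP.hasFDerivAt
  have hV := hv.hasFDerivAt.comp w hP.hasFDerivAt
  have hG := (hU.smul_const (1 : ℂ)).fun_add (hV.smul_const Complex.I)
  have e : (fun z => (u (P z) : ℂ) + v (P z) * Complex.I) =
      fun z => (u ∘ P) z • (1 : ℂ) + (v ∘ P) z • Complex.I := by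
    funext z; simp
  rw [e, differentiableAt_complex_iff_differentiableAt_real, hG.fderiv,
    and_iff_right hG.differentiableAt]
  simp [hX', hY', Complex.ext_iff]
  rw [and_comm, eq_comm]

/-- A chart of a two-real-dimensional surface through `t₀ + s r₀ k`: stereographic projection on
the unit sphere from the pole `-s k`, combined with the shear `a` in the half-plane `(t, r)`. -/
def poleChart (t₀ r₀ s a : ℝ) (w : ℂ) : ℍ[ℝ] :=
  qmk (t₀ + a * w.re)
    ((r₀ + a * w.im) * (2 * w.re / (1 + w.re ^ 2 + w.im ^ 2)))
    ((r₀ + a * w.im) * (-2 * s * w.im / (1 + w.re ^ 2 + w.im ^ 2)))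
    ((r₀ + a * w.im) * (s * (1 - w.re ^ 2 - w.im ^ 2) / (1 + w.re ^ 2 + w.im ^ 2)))

theorem differentiable_poleChart (t₀ r₀ s a : ℝ) : Differentiable ℝ (poleChart t₀ r₀ s a) := by
  intro w
  have hre : DifferentiableAt ℝ Complex.re w := Complex.reCLM.differentiableAt
  have him : DifferentiableAt ℝ Complex.im w := Complex.imCLM.differentiableAt
  have hN : (1 + w.re ^ 2 + w.im ^ 2) ≠ 0 := by positivity
  refine differentiableAt_quaternion_mk ?_ ?_ ?_ ?_ <;> fun_prop (disch := assumption)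

theorem hasDerivAt_poleChart_re (t₀ r₀ s a : ℝ) (w : ℂ) :
    HasDerivAt (fun h : ℝ => poleChart t₀ r₀ s a (w + h))
      (qmk a
        ((r₀ + a * w.im) * ((2 + 2 * w.im ^ 2 - 2 * w.re ^ 2) / (1 + w.re ^ 2 + w.im ^ 2) ^ 2))
        ((r₀ + a * w.im) * (4 * s * w.re * w.im / (1 + w.re ^ 2 + w.im ^ 2) ^ 2))
        ((r₀ + a * w.im) * (-4 * s * w.re / (1 + w.re ^ 2 + w.im ^ 2) ^ 2))) 0 := by
  have hx : HasDerivAt (fun h : ℝ => w.re + h) 1 0 := (hasDerivAt_id' (0 : ℝ)).const_add _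
  have hN : (1 + (w.re + 0) ^ 2 + w.im ^ 2) ≠ 0 := by positivity
  have hN' : (1 + w.re ^ 2 + w.im ^ 2) ≠ 0 := by positivity
  have hD := ((hx.fun_pow 2).const_add 1).add_const (w.im ^ 2)
  simp only [poleChart, Complex.add_re, Complex.add_im, Complex.ofReal_re, Complex.ofReal_im,
    add_zero]
  refine hasDerivAt_quaternion_mk ?_ ?_ ?_ ?_
  · simpa using (hx.const_mul a).const_add t₀
  · refine (((hx.const_mul 2).fun_div hD hN).const_mul (r₀ + a * w.im)).congr_deriv ?_
    simp only [add_zero, Nat.cast_ofNat]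
    field_simp
    ring
  · refine (((hasDerivAt_const 0 (-2 * s * w.im)).fun_div hD hN).const_mul
      (r₀ + a * w.im)).congr_deriv ?_
    simp only [add_zero, Nat.cast_ofNat]
    field_simp
    ring
  · refine (((((hx.fun_pow 2).const_sub 1).sub_const (w.im ^ 2)).const_mul s).fun_div hD
      hN |>.const_mul (r₀ + a * w.im)).congr_deriv ?_
    simp only [add_zero, Nat.cast_ofNat]
    field_simp
    ring

theorem hasDerivAt_poleChart_im (t₀ r₀ s a : ℝ) (w : ℂ) :
    HasDerivAt (fun h : ℝ => poleChart t₀ r₀ s a (w + h * Complex.I))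
      (qmk 0
        (a * (2 * w.re / (1 + w.re ^ 2 + w.im ^ 2)) +
          (r₀ + a * w.im) * (-4 * w.re * w.im / (1 + w.re ^ 2 + w.im ^ 2) ^ 2))
        (a * (-2 * s * w.im / (1 + w.re ^ 2 + w.im ^ 2)) + (r₀ + a * w.im) *
          (s * (2 * w.im ^ 2 - 2 * w.re ^ 2 - 2) / (1 + w.re ^ 2 + w.im ^ 2) ^ 2))
        (a * (s * (1 - w.re ^ 2 - w.im ^ 2) / (1 + w.re ^ 2 + w.im ^ 2)) +
          (r₀ + a * w.im) * (-4 * s * w.im / (1 + w.re ^ 2 + w.im ^ 2) ^ 2))) 0 := by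
  have hy : HasDerivAt (fun h : ℝ => w.im + h) 1 0 := (hasDerivAt_id' (0 : ℝ)).const_add _
  have hN : (1 + w.re ^ 2 + (w.im + 0) ^ 2) ≠ 0 := by positivity
  have hN' : (1 + w.re ^ 2 + w.im ^ 2) ≠ 0 := by positivity
  have hD := (hy.fun_pow 2).const_add (1 + w.re ^ 2)
  have hR := (hy.const_mul a).const_add r₀
  simp only [poleChart, Complex.add_re, Complex.add_im, Complex.re_ofReal_mul,
    Complex.im_ofReal_mul, Complex.I_re, Complex.I_im, mul_zero, mul_one, add_zero]
  refine hasDerivAt_quaternion_mk (hasDerivAt_const _ _) ?_ ?_ ?_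
  · refine (hR.fun_mul ((hasDerivAt_const 0 (2 * w.re)).fun_div hD hN)).congr_deriv ?_
    simp only [add_zero, Nat.cast_ofNat]
    field_simp
    ring
  · refine (hR.fun_mul ((hy.const_mul (-2 * s)).fun_div hD hN)).congr_deriv ?_
    simp only [add_zero, Nat.cast_ofNat]
    field_simp
    ring
  · refine (hR.fun_mul ((((hy.fun_pow 2).const_sub (1 - w.re ^ 2)).const_mul s).fun_div hD
      hN)).congr_deriv ?_
    simp only [add_zero, Nat.cast_ofNat]
    field_simp
    ring

theorem CauchyRiemannAt.fderiv_eq {u v : ℍ[ℝ] → ℝ} {p : ℍ[ℝ]} (h : CauchyRiemannAt u v p)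
    {r a σ₁ σ₂ σ₃ ξ₁ ξ₂ ξ₃ η₁ η₂ η₃ : ℝ} (hr : 0 < r)
    (hI : p.imI = r * σ₁) (hJ : p.imJ = r * σ₂) (hK : p.imK = r * σ₃)
    (hσ : σ₁ ^ 2 + σ₂ ^ 2 + σ₃ ^ 2 = 1) (hξ : ξ₁ * σ₁ + ξ₂ * σ₂ + ξ₃ * σ₃ = 0)
    (hη₁ : η₁ = ξ₂ * σ₃ - ξ₃ * σ₂) (hη₂ : η₂ = ξ₃ * σ₁ - ξ₁ * σ₃)
    (hη₃ : η₃ = ξ₁ * σ₂ - ξ₂ * σ₁) :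
    fderiv ℝ u p (qmk a (r * ξ₁) (r * ξ₂) (r * ξ₃)) =
        fderiv ℝ v p (qmk 0 (a * σ₁ + r * η₁) (a * σ₂ + r * η₂) (a * σ₃ + r * η₃)) ∧
      fderiv ℝ u p (qmk 0 (a * σ₁ + r * η₁) (a * σ₂ + r * η₂) (a * σ₃ + r * η₃)) =
        -fderiv ℝ v p (qmk a (r * ξ₁) (r * ξ₂) (r * ξ₃)) := by
  have hrr : rr p = r := by
    rw [← sq_eq_sq₀ (show 0 ≤ rr p from Real.sqrt_nonneg _) hr.le, rr_sq, hI, hJ, hK]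
    linear_combination r ^ 2 * hσ
  obtain ⟨h0, h1, h2, h3⟩ := h
  rw [hrr, hI, hJ, hK] at *
  simp only [clm_apply_eq _ (qmk _ _ _ _), qmk_re, qmk_imI, qmk_imJ, qmk_imK, smul_eq_mul]
  generalize fderiv ℝ u p 1 = ut, fderiv ℝ u p qi = ui, fderiv ℝ u p qj = uj,
    fderiv ℝ u p qk = uk, fderiv ℝ v p 1 = vt, fderiv ℝ v p qi = vi, fderiv ℝ v p qj = vj,
    fderiv ℝ v p qk = vk at *
  subst hη₁ hη₂ hη₃
  replace h0 : ut = σ₁ * vi + σ₂ * vj + σ₃ * vk := by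
    apply mul_left_cancel₀ hr.ne'; linear_combination h0
  replace h1 : ui + σ₁ * vt + (σ₃ * vj - σ₂ * vk) = 0 := by
    apply mul_left_cancel₀ hr.ne'; linear_combination h1
  replace h2 : uj + σ₂ * vt + (σ₁ * vk - σ₃ * vi) = 0 := by
    apply mul_left_cancel₀ hr.ne'; linear_combination h2
  replace h3 : uk + σ₃ * vt + (σ₂ * vi - σ₁ * vj) = 0 := by
    apply mul_left_cancel₀ hr.ne'; linear_combination h3
  constructor
  · linear_combination a * h0 + r * (ξ₁ * h1 + ξ₂ * h2 + ξ₃ * h3) - r * vt * hξ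
  · linear_combination a * (σ₁ * h1 + σ₂ * h2 + σ₃ * h3)
      + r * ((ξ₂ * σ₃ - ξ₃ * σ₂) * h1 + (ξ₃ * σ₁ - ξ₁ * σ₃) * h2 + (ξ₁ * σ₂ - ξ₂ * σ₁) * h3)
      - a * vt * hσ - r * (ξ₁ * vi + ξ₂ * vj + ξ₃ * vk) * hσ
      + r * (σ₁ * vi + σ₂ * vj + σ₃ * vk) * hξ

theorem CauchyRiemannAt.differentiableAt_comp_poleChart {u v : ℍ[ℝ] → ℝ} {t₀ r₀ s a : ℝ} {w : ℂ}
    (hs : s ^ 2 = 1) (hr : 0 < r₀ + a * w.im)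
    (hu : DifferentiableAt ℝ u (poleChart t₀ r₀ s a w))
    (hv : DifferentiableAt ℝ v (poleChart t₀ r₀ s a w))
    (h : CauchyRiemannAt u v (poleChart t₀ r₀ s a w)) :
    DifferentiableAt ℂ (fun z => (u (poleChart t₀ r₀ s a z) : ℂ)
      + v (poleChart t₀ r₀ s a z) * Complex.I) w := by
  have hN : (1 + w.re ^ 2 + w.im ^ 2) ≠ 0 := by positivity
  refine (differentiableAt_complex_comp_iff hu hv (differentiable_poleChart _ _ _ _ w)
    (hasDerivAt_poleChart_re _ _ _ _ w) (hasDerivAt_poleChart_im _ _ _ _ w)).2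
    (h.fderiv_eq hr rfl rfl rfl ?_ ?_ ?_ ?_ ?_)
  · field_simp
    linear_combination (4 * w.im ^ 2 + (1 - w.re ^ 2 - w.im ^ 2) ^ 2) * hs
  · field_simp
    linear_combination (-8 * w.re * w.im ^ 2 - 4 * w.re * (1 - w.re ^ 2 - w.im ^ 2)) * hs
  · field_simp
    linear_combination (w.re * w.im * (1 + w.re ^ 2 + w.im ^ 2)) * hs
  · field_simp
    ring
  · field_simp
    ring

theorem cauchyRiemannAt_of_eventually {u v : ℍ[ℝ] → ℝ} {p : ℍ[ℝ]} (hp : qim p ≠ 0)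
    (hpI : p.imI = 0) (hpJ : p.imJ = 0)
    (hu : ∀ᶠ q in nhds p, DifferentiableAt ℝ u q) (hv : ∀ᶠ q in nhds p, DifferentiableAt ℝ v q)
    (h : ∀ᶠ q in nhds p, q.imI ≠ 0 ∨ q.imJ ≠ 0 → CauchyRiemannAt u v q) :
    CauchyRiemannAt u v p := by
  have hr := rr_pos hp
  have hr2 := rr_sq p
  obtain ⟨s, hs, hsK⟩ : ∃ s : ℝ, s ^ 2 = 1 ∧ p.imK = rr p * s := by
    refine ⟨p.imK / rr p, ?_, by field_simp⟩
    rw [div_pow, hr2, hpI, hpJ]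
    rw [hpI, hpJ] at hr2
    refine div_eq_one_iff_eq ?_ |>.2 (by ring)
    rw [← hr2]; positivity
  have hp0 (a : ℝ) : poleChart p.re (rr p) s a 0 = p := by
    ext <;> simp [poleChart, hpI, hpJ, hsK]
  have key (a : ℝ) : fderiv ℝ u p (qmk a (rr p * 2) 0 0) =
        fderiv ℝ v p (qmk 0 0 (rr p * (s * -2)) (a * s)) ∧
      fderiv ℝ u p (qmk 0 0 (rr p * (s * -2)) (a * s)) =
        -fderiv ℝ v p (qmk a (rr p * 2) 0 0) := by
    have hd := differentiable_poleChart p.re (rr p) s a 0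
    have hc : Filter.Tendsto (poleChart p.re (rr p) s a) (nhds 0) (nhds p) := by
      simpa only [ContinuousAt, hp0] using hd.continuousAt
    have hu0 : DifferentiableAt ℝ u (poleChart p.re (rr p) s a 0) := by
      rw [hp0]; exact hu.self_of_nhds
    have hv0 : DifferentiableAt ℝ v (poleChart p.re (rr p) s a 0) := by
      rw [hp0]; exact hv.self_of_nhds
    have hpos : ∀ᶠ w : ℂ in nhds 0, 0 < rr p + a * w.im := by
      have hcont : Continuous fun w : ℂ => rr p + a * w.im := by fun_prop
      exact hcont.continuousAt.eventually_const_lt (by simpa using hr)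
    have han : AnalyticAt ℂ (fun z => (u (poleChart p.re (rr p) s a z) : ℂ)
        + v (poleChart p.re (rr p) s a z) * Complex.I) 0 := by
      refine Complex.analyticAt_of_differentiable_on_punctured_nhds_of_continuousAt ?_ ?_
      · refine eventually_nhdsWithin_iff.2 ?_
        filter_upwards [hc.eventually hu, hc.eventually hv, hc.eventually h, hpos]
          with w hwu hwv hw hwr hw0
        refine (hw ?_).differentiableAt_comp_poleChart hs hwr hwu hwv
        by_contra! hcon
        obtain ⟨h1, h2⟩ := hcon
        have hN : (1 + w.re ^ 2 + w.im ^ 2) ≠ 0 := by positivity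
        have hs0 : s ≠ 0 := by rintro rfl; norm_num at hs
        simp [poleChart, hwr.ne', hN, hs0] at h1 h2
        exact hw0 (Complex.ext h1 h2)
      · have h1 := hu0.continuousAt.comp hd.continuousAt
        have h2 := hv0.continuousAt.comp hd.continuousAt
        exact (Complex.continuous_ofReal.continuousAt.comp h1).add
          ((Complex.continuous_ofReal.continuousAt.comp h2).mul continuousAt_const)
    have := (differentiableAt_complex_comp_iff hu0 hv0 hd (hasDerivAt_poleChart_re _ _ _ _ 0)
      (hasDerivAt_poleChart_im _ _ _ _ 0)).1 han.differentiableAt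
    simpa [hp0] using this
  obtain ⟨a1, a2⟩ := key 0
  obtain ⟨b1, b2⟩ := key 1
  rw [CauchyRiemannAt, hpI, hpJ, hsK]
  simp only [clm_apply_eq _ (qmk _ _ _ _), qmk_re, qmk_imI, qmk_imJ, qmk_imK, smul_eq_mul] at *
  refine ⟨?_, ?_, ?_, ?_⟩
  · linear_combination rr p * (b1 - a1)
  · linear_combination a1 / 2
  · linear_combination -s / 2 * a2 - rr p * fderiv ℝ u p qj * hs
  · linear_combination s * rr p * (b2 - a2) - rr p * fderiv ℝ u p qk * hs

/-- Characterization of hyperholomorphic functions via Cauchy–Riemann-type equations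
in the coordinates (t,r,α,β). -/
theorem hyperholo_iff_CR (Ω : Set ℍ[ℝ]) (hΩ : IsOpen Ω)
    (hax : ∀ p ∈ Ω, qim p ≠ 0)
    (f : ℍ[ℝ] → ℍ[ℝ]) (u v : ℍ[ℝ] → ℝ)
    (hcl : ∀ p ∈ Ω, f p = (u p : ℍ[ℝ]) + iota p * (v p : ℍ[ℝ]))
    (hdiff : ∀ p ∈ Ω, DifferentiableAt ℝ f p) :
    (∀ p ∈ Ω, Dl f p = ((-2 * v p / rr p : ℝ) : ℍ[ℝ])) ↔
      (∀ t r α β : ℝ, 0 < r → Real.sin β ≠ 0 → pt t r α β ∈ Ω →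
        (deriv (fun s => u (pt s r α β)) t - deriv (fun s => v (pt t s α β)) r = 0 ∧
         deriv (fun s => v (pt s r α β)) t + deriv (fun s => u (pt t s α β)) r = 0 ∧
         (Real.sin β)⁻¹ * deriv (fun s => v (pt t r s β)) α
            + deriv (fun s => u (pt t r α s)) β = 0 ∧
         (Real.sin β)⁻¹ * deriv (fun s => u (pt t r s β)) α
            - deriv (fun s => v (pt t r α s)) β = 0)) := by
  have hax' : ∀ p ∈ Ω, ∀ᶠ q in nhds p, qim q ≠ 0 := fun p hp =>
    Filter.eventually_of_mem (hΩ.mem_nhds hp) hax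
  have hcl' : ∀ p ∈ Ω, ∀ᶠ q in nhds p, f q = (u q : ℍ[ℝ]) + iota q * (v q : ℍ[ℝ]) :=
    fun p hp => Filter.eventually_of_mem (hΩ.mem_nhds hp) hcl
  have huv : ∀ p ∈ Ω, DifferentiableAt ℝ u p ∧ DifferentiableAt ℝ v p := fun p hp =>
    differentiableAt_of_complexLike (hax p hp) (hax' p hp) (hcl' p hp) (hdiff p hp)
  have hDl : ∀ p ∈ Ω, Dl f p = ((-2 * v p / rr p : ℝ) : ℍ[ℝ]) ↔ CauchyRiemannAt u v p :=
    fun p hp => Dl_eq_iff_cauchyRiemannAt (hax p hp) (hcl' p hp) (huv p hp).1 (huv p hp).2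
  constructor
  · intro h t r α β hr hβ hp
    exact (cauchyRiemannAt_pt_iff hr hβ (huv _ hp).1 (huv _ hp).2).1 ((hDl _ hp).1 (h _ hp))
  · intro h
    have off_axis : ∀ p ∈ Ω, p.imI ≠ 0 ∨ p.imJ ≠ 0 → CauchyRiemannAt u v p := by
      intro p hp hpk
      obtain ⟨t, r, α, β, hr, hβ, rfl⟩ := exists_pt_eq hpk
      exact (cauchyRiemannAt_pt_iff hr hβ (huv _ hp).1 (huv _ hp).2).2 (h t r α β hr hβ hp)
    intro p hp
    refine (hDl p hp).2 ?_
    by_cases hpk : p.imI ≠ 0 ∨ p.imJ ≠ 0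
    · exact off_axis p hp hpk
    · push Not at hpk
      have hmem := hΩ.mem_nhds hp
      exact cauchyRiemannAt_of_eventually (hax p hp) hpk.1 hpk.2
        (Filter.eventually_of_mem hmem fun q hq => (huv q hq).1)
        (Filter.eventually_of_mem hmem fun q hq => (huv q hq).2)
        (Filter.eventually_of_mem hmem off_axis)
end
end

section
/- Let Ω ⊆ H be an open set disjoint from the real axis and let f = u + ιv be hyperholomorphic and three times continuously differentiable on Ω. Then D_l(Δf) = 0 and D_r(Δf) = 0 on Ω, where Δf = ∂²f/∂t² + ∂²f/∂x² + ∂²f/∂y² + ∂²f/∂z² is the four-dimensional Laplacian of f. In other words, Δf is regular in the sense of Fueter, both on the left and on the right. -/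
open Quaternion MeasureTheory

noncomputable section

/-- The four-dimensional Laplacian of f. -/
def lap (f : ℍ[ℝ] → ℍ[ℝ]) (q : ℍ[ℝ]) : ℍ[ℝ] :=
  fderiv ℝ (fun w => fderiv ℝ f w 1) q 1 +
  fderiv ℝ (fun w => fderiv ℝ f w qi) q qi +
  fderiv ℝ (fun w => fderiv ℝ f w qj) q qj +
  fderiv ℝ (fun w => fderiv ℝ f w qk) q qk

section SecondDerivatives

variable {E F : Type*} [NormedAddCommGroup E] [NormedSpace ℝ E]
  [NormedAddCommGroup F] [NormedSpace ℝ F]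

theorem ContDiffAt.differentiableAt_fderiv_two {g : E → F} {p : E} (hg : ContDiffAt ℝ 2 g p) :
    DifferentiableAt ℝ (fderiv ℝ g) p :=
  (hg.fderiv_right (m := 1) (by norm_num)).differentiableAt (by norm_num)

theorem ContDiffAt.hasFDerivAt_fderiv_apply {g : E → F} {p : E} (hg : ContDiffAt ℝ 2 g p)
    (a : E) :
    HasFDerivAt (fun q => fderiv ℝ g q a) ((fderiv ℝ (fderiv ℝ g) p).flip a) p := by
  simpa using hg.differentiableAt_fderiv_two.hasFDerivAt.clm_apply (hasFDerivAt_const a p)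

theorem ContDiffAt.fderiv_fderiv_apply {g : E → F} {p : E} (hg : ContDiffAt ℝ 2 g p) (a b : E) :
    fderiv ℝ (fun q => fderiv ℝ g q a) p b = fderiv ℝ (fderiv ℝ g) p b a := by
  rw [(hg.hasFDerivAt_fderiv_apply a).fderiv]; rfl

theorem ContDiffAt.fderiv_fderiv_symm {g : E → F} {p : E} (hg : ContDiffAt ℝ 2 g p) (a b : E) :
    fderiv ℝ (fderiv ℝ g) p a b = fderiv ℝ (fderiv ℝ g) p b a :=
  hg.isSymmSndFDerivAt (by simp) a b

/-- Second directional derivative of the product of a linear form and a function. -/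
theorem ContDiffAt.fderiv_fderiv_clm_mul {w : E → ℝ} {p : E} (hw : ContDiffAt ℝ 2 w p)
    (l : E →L[ℝ] ℝ) (a : E) :
    fderiv ℝ (fderiv ℝ (fun q => l q * w q)) p a a =
      l p * fderiv ℝ (fderiv ℝ w) p a a + 2 * (l a * fderiv ℝ w p a) := by
  have hl : ContDiffAt ℝ 2 (fun q => l q * w q) p := l.contDiff.contDiffAt.mul hw
  rw [← hl.fderiv_fderiv_apply]
  have hev : (fun q => fderiv ℝ (fun q => l q * w q) q a) =ᶠ[nhds p]
      fun q => l q * fderiv ℝ w q a + w q * l a := by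
    filter_upwards [hw.eventually (by simp)] with q hq
    rw [fderiv_fun_mul l.differentiableAt (hq.differentiableAt (by norm_num))]
    simp
  rw [hev.fderiv_eq]
  have h := (l.hasFDerivAt (x := p)).mul (hw.hasFDerivAt_fderiv_apply a)
  have h' := ((hw.differentiableAt (by norm_num)).hasFDerivAt).mul_const (l a)
  have h2 : HasFDerivAt (fun q => l q * fderiv ℝ w q a + w q * l a) _ p := h.add h'
  rw [h2.fderiv]
  simp
  ring

/-- Continuous linear maps commute with second derivatives. -/
theorem ContDiffAt.fderiv_fderiv_clm_comp {G : Type*} [NormedAddCommGroup G] [NormedSpace ℝ G]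
    {g : E → F} {p : E} (hg : ContDiffAt ℝ 2 g p) (l : F →L[ℝ] G) (a b : E) :
    fderiv ℝ (fderiv ℝ (fun q => l (g q))) p a b = l (fderiv ℝ (fderiv ℝ g) p a b) := by
  have hl : ContDiffAt ℝ 2 (fun q => l (g q)) p := l.contDiff.contDiffAt.comp p hg
  rw [← hl.fderiv_fderiv_apply]
  have hev : (fun q => fderiv ℝ (fun q => l (g q)) q b) =ᶠ[nhds p]
      fun q => l (fderiv ℝ g q b) := by
    filter_upwards [hg.eventually (by simp)] with q hq
    have h := l.hasFDerivAt.comp q (hq.differentiableAt (by norm_num)).hasFDerivAt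
    have h' : HasFDerivAt (fun q => l (g q)) _ q := h
    rw [h'.fderiv]
    rfl
  rw [hev.fderiv_eq]
  have h : HasFDerivAt (fun q => l (fderiv ℝ g q b)) _ p :=
    l.hasFDerivAt.comp p (hg.hasFDerivAt_fderiv_apply b)
  rw [h.fderiv]
  rfl

end SecondDerivatives

/-- The coordinate `imI` as a continuous linear form. -/
def imIForm : ℍ[ℝ] →L[ℝ] ℝ :=
  LinearMap.toContinuousLinearMap
    { toFun := fun p => p.imI, map_add' := fun _ _ => rfl, map_smul' := fun _ _ => rfl }

/-- The coordinate `imJ` as a continuous linear form. -/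
def imJForm : ℍ[ℝ] →L[ℝ] ℝ :=
  LinearMap.toContinuousLinearMap
    { toFun := fun p => p.imJ, map_add' := fun _ _ => rfl, map_smul' := fun _ _ => rfl }

/-- The coordinate `imK` as a continuous linear form. -/
def imKForm : ℍ[ℝ] →L[ℝ] ℝ :=
  LinearMap.toContinuousLinearMap
    { toFun := fun p => p.imK, map_add' := fun _ _ => rfl, map_smul' := fun _ _ => rfl }

/-- The coordinate `re` as a continuous linear form. -/
def reForm : ℍ[ℝ] →L[ℝ] ℝ :=
  LinearMap.toContinuousLinearMap
    { toFun := fun p => p.re, map_add' := fun _ _ => rfl, map_smul' := fun _ _ => rfl }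

@[simp] theorem imIForm_apply (p : ℍ[ℝ]) : imIForm p = p.imI := rfl
@[simp] theorem imJForm_apply (p : ℍ[ℝ]) : imJForm p = p.imJ := rfl
@[simp] theorem imKForm_apply (p : ℍ[ℝ]) : imKForm p = p.imK := rfl
@[simp] theorem reForm_apply (p : ℍ[ℝ]) : reForm p = p.re := rfl

/-- The Laplacian of a real-valued function in terms of its second derivative. -/
def realLap (w : ℍ[ℝ] → ℝ) (p : ℍ[ℝ]) : ℝ :=
  fderiv ℝ (fderiv ℝ w) p 1 1 + fderiv ℝ (fderiv ℝ w) p qi qi +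
    fderiv ℝ (fderiv ℝ w) p qj qj + fderiv ℝ (fderiv ℝ w) p qk qk

theorem lap_eq {f : ℍ[ℝ] → ℍ[ℝ]} {p : ℍ[ℝ]} (hf : ContDiffAt ℝ 2 f p) :
    lap f p = fderiv ℝ (fderiv ℝ f) p 1 1 + fderiv ℝ (fderiv ℝ f) p qi qi +
      fderiv ℝ (fderiv ℝ f) p qj qj + fderiv ℝ (fderiv ℝ f) p qk qk := by
  simp only [lap, hf.fderiv_fderiv_apply]

theorem clm_lap {f : ℍ[ℝ] → ℍ[ℝ]} {p : ℍ[ℝ]} (hf : ContDiffAt ℝ 2 f p) (l : ℍ[ℝ] →L[ℝ] ℝ) :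
    l (lap f p) = realLap (fun q => l (f q)) p := by
  simp only [realLap, lap_eq hf, hf.fderiv_fderiv_clm_comp l, map_add]

theorem realLap_clm_mul {w : ℍ[ℝ] → ℝ} {p : ℍ[ℝ]} (hw : ContDiffAt ℝ 2 w p)
    (l : ℍ[ℝ] →L[ℝ] ℝ) :
    realLap (fun q => l q * w q) p = l p * realLap w p +
      2 * (l 1 * fderiv ℝ w p 1 + l qi * fderiv ℝ w p qi + l qj * fderiv ℝ w p qj +
        l qk * fderiv ℝ w p qk) := by
  simp only [realLap, hw.fderiv_fderiv_clm_mul l]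
  ring

theorem realLap_congr {w w' : ℍ[ℝ] → ℝ} {p : ℍ[ℝ]} (h : w =ᶠ[nhds p] w') :
    realLap w p = realLap w' p := by
  simp only [realLap, h.fderiv.fderiv_eq]

/-- The conjugate Fueter operator applied to the real function `-2 w`. -/
def conjFueter (w : ℍ[ℝ] → ℝ) (p : ℍ[ℝ]) : ℍ[ℝ] :=
  (-2 * fderiv ℝ w p 1) • (1 : ℍ[ℝ]) + (2 * fderiv ℝ w p qi) • qi +
    (2 * fderiv ℝ w p qj) • qj + (2 * fderiv ℝ w p qk) • qk

theorem ContDiffAt.fderiv_Dl {f : ℍ[ℝ] → ℍ[ℝ]} {p : ℍ[ℝ]} (hf : ContDiffAt ℝ 2 f p)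
    (b : ℍ[ℝ]) :
    fderiv ℝ (Dl f) p b = fderiv ℝ (fderiv ℝ f) p b 1 + qi * fderiv ℝ (fderiv ℝ f) p b qi +
      qj * fderiv ℝ (fderiv ℝ f) p b qj + qk * fderiv ℝ (fderiv ℝ f) p b qk := by
  have h : HasFDerivAt (Dl f) _ p :=
    (((hf.hasFDerivAt_fderiv_apply 1).add ((hf.hasFDerivAt_fderiv_apply qi).const_mul qi)).add
      ((hf.hasFDerivAt_fderiv_apply qj).const_mul qj)).add
      ((hf.hasFDerivAt_fderiv_apply qk).const_mul qk)
  rw [h.fderiv]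
  rfl

theorem ContDiffAt.contDiffAt_Dl {f : ℍ[ℝ] → ℍ[ℝ]} {p : ℍ[ℝ]} (hf : ContDiffAt ℝ 3 f p) :
    ContDiffAt ℝ 2 (Dl f) p := by
  have h : ContDiffAt ℝ 2 (fderiv ℝ f) p := hf.fderiv_right (by norm_num)
  have ha (a : ℍ[ℝ]) : ContDiffAt ℝ 2 (fun q => fderiv ℝ f q a) p := h.clm_apply contDiffAt_const
  exact (((ha 1).add (contDiffAt_const.mul (ha qi))).add (contDiffAt_const.mul (ha qj))).add
    (contDiffAt_const.mul (ha qk))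

/-- The Laplacian factors as the conjugate Fueter operator after the left Fueter operator. -/
theorem lap_eq_conjFueter {f : ℍ[ℝ] → ℍ[ℝ]} {w : ℍ[ℝ] → ℝ} {p : ℍ[ℝ]}
    (hf : ContDiffAt ℝ 2 f p) (hw : DifferentiableAt ℝ w p)
    (h : Dl f =ᶠ[nhds p] fun q => (-2 * w q) • (1 : ℍ[ℝ])) : lap f p = conjFueter w p := by
  have key (b : ℍ[ℝ]) : fderiv ℝ (fderiv ℝ f) p b 1 + qi * fderiv ℝ (fderiv ℝ f) p b qi +
      qj * fderiv ℝ (fderiv ℝ f) p b qj + qk * fderiv ℝ (fderiv ℝ f) p b qk =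
      (-2 * fderiv ℝ w p b) • (1 : ℍ[ℝ]) := by
    rw [← hf.fderiv_Dl, h.fderiv_eq,
      ((hw.hasFDerivAt.const_mul (-2)).smul_const (1 : ℍ[ℝ])).fderiv]
    simp
  have h1 := key 1
  have hi := key qi
  have hj := key qj
  have hk := key qk
  rw [hf.fderiv_fderiv_symm qi 1] at hi
  rw [hf.fderiv_fderiv_symm qj 1, hf.fderiv_fderiv_symm qj qi] at hj
  rw [hf.fderiv_fderiv_symm qk 1, hf.fderiv_fderiv_symm qk qi, hf.fderiv_fderiv_symm qk qj] at hk
  rw [lap_eq hf, conjFueter]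
  generalize fderiv ℝ (fderiv ℝ f) p = B at *
  simp only [Quaternion.ext_iff] at h1 hi hj hk ⊢
  simp at h1 hi hj hk ⊢
  refine ⟨?_, ?_, ?_, ?_⟩ <;> linarith

/-- The conjugate Fueter operator maps harmonic real functions to left and right regular ones. -/
theorem regular_conjFueter {w : ℍ[ℝ] → ℝ} {p : ℍ[ℝ]} (hw : ContDiffAt ℝ 2 w p)
    (h : realLap w p = 0) : Dl (conjFueter w) p = 0 ∧ Dr (conjFueter w) p = 0 := by
  have key (b : ℍ[ℝ]) : fderiv ℝ (conjFueter w) p b =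
      (-2 * fderiv ℝ (fderiv ℝ w) p b 1) • (1 : ℍ[ℝ]) +
      (2 * fderiv ℝ (fderiv ℝ w) p b qi) • qi +
      (2 * fderiv ℝ (fderiv ℝ w) p b qj) • qj + (2 * fderiv ℝ (fderiv ℝ w) p b qk) • qk := by
    have hc : HasFDerivAt (conjFueter w) _ p :=
      (((((hw.hasFDerivAt_fderiv_apply 1).const_mul (-2)).smul_const (1 : ℍ[ℝ])).add
      (((hw.hasFDerivAt_fderiv_apply qi).const_mul 2).smul_const qi)).add
      (((hw.hasFDerivAt_fderiv_apply qj).const_mul 2).smul_const qj)).add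
      (((hw.hasFDerivAt_fderiv_apply qk).const_mul 2).smul_const qk)
    rw [hc.fderiv]
    rfl
  simp only [Dl, Dr, key, hw.fderiv_fderiv_symm qi 1, hw.fderiv_fderiv_symm qj 1,
    hw.fderiv_fderiv_symm qj qi, hw.fderiv_fderiv_symm qk 1, hw.fderiv_fderiv_symm qk qi,
    hw.fderiv_fderiv_symm qk qj]
  rw [realLap] at h
  generalize fderiv ℝ (fderiv ℝ w) p = B at *
  constructor <;> ext <;> simp <;> linarith

theorem Filter.EventuallyEq.Dl_eq {f g : ℍ[ℝ] → ℍ[ℝ]} {p : ℍ[ℝ]} (h : f =ᶠ[nhds p] g) :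
    Dl f p = Dl g p := by
  simp only [Dl, h.fderiv_eq]

theorem Filter.EventuallyEq.Dr_eq {f g : ℍ[ℝ] → ℍ[ℝ]} {p : ℍ[ℝ]} (h : f =ᶠ[nhds p] g) :
    Dr f p = Dr g p := by
  simp only [Dr, h.fderiv_eq]

/-- Generalized Fueter theorem: the Laplacian of a hyperholomorphic function is
left- and right-regular in the sense of Fueter. -/
theorem fueter_thm (Ω : Set ℍ[ℝ]) (hΩ : IsOpen Ω)
    (hax : ∀ p ∈ Ω, qim p ≠ 0)
    (f : ℍ[ℝ] → ℍ[ℝ]) (u v : ℍ[ℝ] → ℝ)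
    (hf : Hyperholo Ω f u v) (hC3 : ContDiffOn ℝ 3 f Ω) :
    ∀ p ∈ Ω, Dl (lap f) p = 0 ∧ Dr (lap f) p = 0 := by
  obtain ⟨-, hdec, hD⟩ := hf
  set w : ℍ[ℝ] → ℝ := fun p => v p / rr p with hw_def
  have hD' : ∀ q ∈ Ω, Dl f q = (-2 * w q) • (1 : ℍ[ℝ]) := by
    intro q hq
    rw [hD q hq, mul_div_assoc]
    change ((-2 * w q : ℝ) : ℍ[ℝ]) = _
    generalize -2 * w q = c
    ext <;> simp
  have hf3 (q) (hq : q ∈ Ω) : ContDiffAt ℝ 3 f q := hC3.contDiffAt (hΩ.mem_nhds hq)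
  have hf2 (q) (hq : q ∈ Ω) : ContDiffAt ℝ 2 f q := (hf3 q hq).of_le (by norm_num)
  have hw2 (q) (hq : q ∈ Ω) : ContDiffAt ℝ 2 w q := by
    have h : ContDiffAt ℝ 2 (fun q => (-1 / 2) * reForm (Dl f q)) q :=
      contDiffAt_const.mul (reForm.contDiff.contDiffAt.comp q (hf3 q hq).contDiffAt_Dl)
    refine h.congr_of_eventuallyEq ?_
    filter_upwards [hΩ.mem_nhds hq] with s hs
    rw [hD' s hs]
    simp
    ring
  have hlap (q) (hq : q ∈ Ω) : lap f q = conjFueter w q :=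
    lap_eq_conjFueter (hf2 q hq) ((hw2 q hq).differentiableAt (by norm_num))
      (by filter_upwards [hΩ.mem_nhds hq] using hD')
  have hform (l : ℍ[ℝ] →L[ℝ] ℝ) (hl : ∀ q ∈ Ω, l (f q) = l q * w q) (q) (hq : q ∈ Ω) :
      l (conjFueter w q) = l q * realLap w q +
      2 * (l 1 * fderiv ℝ w q 1 + l qi * fderiv ℝ w q qi + l qj * fderiv ℝ w q qj +
        l qk * fderiv ℝ w q qk) := by
    rw [← realLap_clm_mul (hw2 q hq), ← hlap q hq, clm_lap (hf2 q hq)]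
    exact realLap_congr (by filter_upwards [hΩ.mem_nhds hq] using hl)
  intro p hp
  have hharm : realLap w p = 0 := by
    by_contra hne
    have hI := hform imIForm (fun q hq => by simp [hdec q hq, iota, hw_def]; ring) p hp
    have hJ := hform imJForm (fun q hq => by simp [hdec q hq, iota, hw_def]; ring) p hp
    have hK := hform imKForm (fun q hq => by simp [hdec q hq, iota, hw_def]; ring) p hp
    simp [conjFueter, hne] at hI hJ hK
    exact hax p hp (by ext <;> simp [hI, hJ, hK])
  have hev : lap f =ᶠ[nhds p] conjFueter w := by
    filter_upwards [hΩ.mem_nhds hp] using hlap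
  rw [hev.Dl_eq, hev.Dr_eq]
  exact regular_conjFueter (hw2 p hp) hharm
end
end

section
/- Let Ω ⊆ H be an open set disjoint from the real axis and let f = u + ιv be hyperholomorphic on Ω. Then f is Cullen-regular on Ω: for every p ∈ Ω, ∂f/∂t(p) + ι(p)·(∂_ι f)(p) = 0, where ∂f/∂t(p) is the directional derivative of f at p along 1 and (∂_ι f)(p) is the directional derivative of f at p along the purely imaginary unit quaternion ι(p) (the radial direction). -/
open Quaternion MeasureTheory

noncomputable section

theorem rr_ne_zero {p : ℍ[ℝ]} (hp : qim p ≠ 0) : rr p ≠ 0 := by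
  intro h
  have h2 := rr_sq p
  rw [h] at h2
  apply hp
  have h1 : p.imI = 0 := by nlinarith [sq_nonneg p.imI, sq_nonneg p.imJ, sq_nonneg p.imK]
  have h3 : p.imJ = 0 := by nlinarith [sq_nonneg p.imI, sq_nonneg p.imJ, sq_nonneg p.imK]
  have h4 : p.imK = 0 := by nlinarith [sq_nonneg p.imI, sq_nonneg p.imJ, sq_nonneg p.imK]
  ext <;> simp [qim, h1, h3, h4]

theorem qim_eq_sum (p : ℍ[ℝ]) : qim p = p.imI • qi + p.imJ • qj + p.imK • qk := by
  ext <;> simp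

/-- A complex-like value commutes with its base point. -/
theorem commute_add_iota_mul (p : ℍ[ℝ]) (a b : ℝ) :
    p * ((a : ℍ[ℝ]) + iota p * (b : ℍ[ℝ])) = ((a : ℍ[ℝ]) + iota p * (b : ℍ[ℝ])) * p := by
  ext <;> simp [iota] <;> ring

/-- Differentiating the relation `q * f q = f q * q`. -/
theorem fderiv_of_eventually_commute {f : ℍ[ℝ] → ℍ[ℝ]} {p : ℍ[ℝ]}
    (hd : DifferentiableAt ℝ f p) (hc : ∀ᶠ q in nhds p, q * f q = f q * q) (h : ℍ[ℝ]) :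
    p * fderiv ℝ f p h + h * f p = f p * h + fderiv ℝ f p h * p := by
  have h1 := (hasFDerivAt_id (𝕜 := ℝ) p).mul' hd.hasFDerivAt
  have h2 := hd.hasFDerivAt.mul' (hasFDerivAt_id (𝕜 := ℝ) p)
  have h3 := h1.unique (h2.congr_of_eventuallyEq hc)
  simpa using congrArg (fun T : ℍ[ℝ] →L[ℝ] ℍ[ℝ] => T h) h3

/-- The algebraic identity behind Cullen regularity: `A, B, C, D` play the role of the partial
derivatives along `1, i, j, k` at `p` of a function with value `a + w • qim p` at `p`. -/
theorem cullen_of_fueter {p g A B C D : ℍ[ℝ]} {a w : ℝ} (hg : g = (a : ℍ[ℝ]) + w • qim p)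
    (hA : p * A + 1 * g = g * 1 + A * p) (hB : p * B + qi * g = g * qi + B * p)
    (hC : p * C + qj * g = g * qj + C * p) (hD : p * D + qk * g = g * qk + D * p)
    (hF : A + qi * B + qj * C + qk * D = ((-2 * w : ℝ) : ℍ[ℝ])) :
    (rr p ^ 2) • A + qim p * (p.imI • B + p.imJ • C + p.imK • D) = 0 := by
  subst hg
  rw [rr_sq]
  simp only [Quaternion.ext_iff] at hA hB hC hD hF
  simp at hA hB hC hD hF
  obtain ⟨-, hA1, hA2, hA3⟩ := hA
  obtain ⟨-, hB1, hB2, hB3⟩ := hB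
  obtain ⟨-, hC1, hC2, hC3⟩ := hC
  obtain ⟨-, hD1, hD2, hD3⟩ := hD
  obtain ⟨hF0, hF1, hF2, hF3⟩ := hF
  ext
  · simp
    linear_combination (p.imI ^ 2 + p.imJ ^ 2 + p.imK ^ 2) * hF0
      + (-p.imJ / 2) * hB3 + (p.imK / 2) * hB2
      + (p.imI / 2) * hC3 + (-p.imK / 2) * hC1
      + (-p.imI / 2) * hD2 + (p.imJ / 2) * hD1
  · simp
    linear_combination p.imI * (p.imI * hF1 + p.imJ * hF2 + p.imK * hF3)
      - p.imJ / 2 * hA3 + p.imK / 2 * hA2 + p.imI / 2 * (hB1 + hC2 + hD3)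
      + p.imI / 2 * hB1 + p.imJ / 2 * hC1 + p.imK / 2 * hD1
  · simp
    linear_combination p.imJ * (p.imI * hF1 + p.imJ * hF2 + p.imK * hF3)
      + p.imI / 2 * hA3 - p.imK / 2 * hA1 + p.imJ / 2 * (hB1 + hC2 + hD3)
      + p.imI / 2 * hB2 + p.imJ / 2 * hC2 + p.imK / 2 * hD2
  · simp
    linear_combination p.imK * (p.imI * hF1 + p.imJ * hF2 + p.imK * hF3)
      - p.imI / 2 * hA2 + p.imJ / 2 * hA1 + p.imK / 2 * (hB1 + hC2 + hD3)
      + p.imI / 2 * hB3 + p.imJ / 2 * hC3 + p.imK / 2 * hD3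

/-- A hyperholomorphic function is Cullen-regular. -/
theorem hyperholo_cullen_regular (Ω : Set ℍ[ℝ]) (hΩ : IsOpen Ω)
    (hax : ∀ p ∈ Ω, qim p ≠ 0)
    (f : ℍ[ℝ] → ℍ[ℝ]) (u v : ℍ[ℝ] → ℝ)
    (hf : Hyperholo Ω f u v) :
    ∀ p ∈ Ω, fderiv ℝ f p 1 + iota p * fderiv ℝ f p (iota p) = 0 := by
  intro p hp
  obtain ⟨hd, hcl, hD⟩ := hf
  have hr := rr_ne_zero (hax p hp)
  have hc : ∀ᶠ q in nhds p, q * f q = f q * q := by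
    filter_upwards [hΩ.mem_nhds hp] with q hq
    rw [hcl q hq]
    exact commute_add_iota_mul q _ _
  have key := fderiv_of_eventually_commute (hd p hp) hc
  have hg : f p = (u p : ℍ[ℝ]) + (v p / rr p) • qim p := by
    rw [hcl p hp, iota, Quaternion.mul_coe_eq_smul, smul_smul, div_eq_mul_inv]
  have hF := hD p hp
  rw [Dl, mul_div_assoc] at hF
  have h := cullen_of_fueter hg (key 1) (key qi) (key qj) (key qk) hF
  have hL : fderiv ℝ f p (qim p) = p.imI • fderiv ℝ f p qi + p.imJ • fderiv ℝ f p qj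
      + p.imK • fderiv ℝ f p qk := by
    conv_lhs => rw [qim_eq_sum]
    simp only [map_add, map_smul]
  rw [← hL] at h
  have h' := congrArg (fun q => (rr p ^ 2)⁻¹ • q) h
  simp only [smul_add, smul_zero, inv_smul_smul₀ (pow_ne_zero 2 hr)] at h'
  rw [← h', iota, map_smul, smul_mul_smul_comm, ← mul_inv, ← sq]
end
end

section
/- (Cullen's integral theorem, box version.) Let B = [a₀,b₀]×[a₁,b₁]×[a₂,b₂]×[a₃,b₃] ⊂ ℝ⁴ ≅ H (coordinates t,x,y,z, with aₘ < bₘ) be a closed box disjoint from the real axis {x = y = z = 0}, and let f = u + ιv be hyperholomorphic on an open neighborhood of B. Write (e₀,e₁,e₂,e₃) = (1,i,j,k). Then the outward flux of the quaternion-valued field through the boundary of B equals the stated volume integral: Σ_{m=0}^{3} [ ∫_{Fₘ⁺} eₘ·f(q)/r(q)² dS − ∫_{Fₘ⁻} eₘ·f(q)/r(q)² dS ] = −2 ∫_B u(q)·ι(q)/r(q)³ dV, where Fₘ⁺ and Fₘ⁻ are the faces of B on which the m-th coordinate equals bₘ and aₘ respectively, dS is three-dimensional Lebesgue measure on each face,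 and dV is four-dimensional Lebesgue measure on B. -/
open Quaternion MeasureTheory

noncomputable section

/-- the quaternion with coordinates (t,x,y,z) -/
def Q (t x y z : ℝ) : ℍ[ℝ] := ⟨t, x, y, z⟩

@[simp] theorem Q_re (t x y z : ℝ) : (Q t x y z).re = t := rfl
@[simp] theorem Q_imI (t x y z : ℝ) : (Q t x y z).imI = x := rfl
@[simp] theorem Q_imJ (t x y z : ℝ) : (Q t x y z).imJ = y := rfl
@[simp] theorem Q_imK (t x y z : ℝ) : (Q t x y z).imK = z := rfl

/-- The `ℝ`-linear coordinate map `ℝ⁴ → ℍ`. -/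
def ofCoords : (Fin 4 → ℝ) →L[ℝ] ℍ[ℝ] :=
  LinearMap.toContinuousLinearMap
    { toFun := fun w => Q (w 0) (w 1) (w 2) (w 3)
      map_add' := fun x y => by ext <;> simp
      map_smul' := fun c x => by ext <;> simp }

theorem ofCoords_apply (w : Fin 4 → ℝ) : ofCoords w = Q (w 0) (w 1) (w 2) (w 3) := rfl

/-- The quaternion units `1, i, j, k`. -/
def unit : Fin 4 → ℍ[ℝ] := ![1, qi, qj, qk]

theorem ofCoords_single (m : Fin 4) : ofCoords (Pi.single m 1) = unit m := by
  fin_cases m <;> ext <;> simp [ofCoords_apply, unit]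

theorem setIntegral_Icc_fin_three {E : Type*} [NormedAddCommGroup E] [NormedSpace ℝ E]
    {a b : Fin 3 → ℝ} {a₀ a₁ a₂ b₀ b₁ b₂ : ℝ} (ha : a = ![a₀, a₁, a₂]) (hb : b = ![b₀, b₁, b₂])
    {g : (Fin 3 → ℝ) → E} {h : ℝ × ℝ × ℝ → E} (hg : ∀ x, g x = h (x 0, x 1, x 2)) :
    ∫ x in Set.Icc a b, g x =
      ∫ w in Set.Icc a₀ b₀ ×ˢ Set.Icc a₁ b₁ ×ˢ Set.Icc a₂ b₂, h w := by
  subst ha hb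
  simp only [hg]
  let e : (Fin 3 → ℝ) ≃ᵐ ℝ × ℝ × ℝ :=
    (MeasurableEquiv.piFinSuccAbove (fun _ => ℝ) 0).trans
      ((MeasurableEquiv.refl ℝ).prodCongr MeasurableEquiv.finTwoArrow)
  have he : MeasurePreserving e volume volume :=
    ((MeasurePreserving.id volume).prod (volume_preserving_finTwoArrow ℝ)).comp
      (volume_preserving_piFinSuccAbove (fun _ => ℝ) 0)
  rw [← he.setIntegral_preimage_emb e.measurableEmbedding]
  congr 2
  ext x
  change x ∈ Set.Icc ![a₀, a₁, a₂] ![b₀, b₁, b₂] ↔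
    (x 0, x 1, x 2) ∈ Set.Icc a₀ b₀ ×ˢ Set.Icc a₁ b₁ ×ˢ Set.Icc a₂ b₂
  simp [Pi.le_def, Fin.forall_fin_succ]

theorem setIntegral_Icc_fin_four {E : Type*} [NormedAddCommGroup E] [NormedSpace ℝ E]
    {a₀ a₁ a₂ a₃ b₀ b₁ b₂ b₃ : ℝ} (h : ℝ × ℝ × ℝ × ℝ → E) :
    ∫ x in Set.Icc ![a₀, a₁, a₂, a₃] ![b₀, b₁, b₂, b₃], h (x 0, x 1, x 2, x 3) =
      ∫ w in Set.Icc a₀ b₀ ×ˢ Set.Icc a₁ b₁ ×ˢ Set.Icc a₂ b₂ ×ˢ Set.Icc a₃ b₃, h w := by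
  let e : (Fin 4 → ℝ) ≃ᵐ ℝ × ℝ × ℝ × ℝ :=
    (MeasurableEquiv.piFinSuccAbove (fun _ => ℝ) 0).trans
      ((MeasurableEquiv.refl ℝ).prodCongr
        ((MeasurableEquiv.piFinSuccAbove (fun _ => ℝ) 0).trans
          ((MeasurableEquiv.refl ℝ).prodCongr MeasurableEquiv.finTwoArrow)))
  have he : MeasurePreserving e volume volume :=
    ((MeasurePreserving.id volume).prod
      (((MeasurePreserving.id volume).prod (volume_preserving_finTwoArrow ℝ)).comp
        (volume_preserving_piFinSuccAbove (fun _ => ℝ) 0))).comp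
      (volume_preserving_piFinSuccAbove (fun _ => ℝ) 0)
  rw [← he.setIntegral_preimage_emb e.measurableEmbedding]
  congr 2
  ext x
  change x ∈ Set.Icc ![a₀, a₁, a₂, a₃] ![b₀, b₁, b₂, b₃] ↔
    (x 0, x 1, x 2, x 3) ∈ Set.Icc a₀ b₀ ×ˢ Set.Icc a₁ b₁ ×ˢ Set.Icc a₂ b₂ ×ˢ Set.Icc a₃ b₃
  simp [Pi.le_def, Fin.forall_fin_succ]

theorem mul_div_rr_sq (e q p : ℍ[ℝ]) :
    e * q / ((rr p ^ 2 : ℝ) : ℍ[ℝ]) = e * ((rr p ^ 2)⁻¹ • q) := by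
  rw [div_eq_mul_inv, ← Quaternion.coe_inv, Quaternion.mul_coe_eq_smul, mul_smul_comm]

theorem iota_mul_iota {p : ℍ[ℝ]} (hp : qim p ≠ 0) : iota p * iota p = -1 := by
  have h := (rr_pos hp).ne'
  have h2 := rr_sq p
  have key : (rr p)⁻¹ * (rr p)⁻¹ * (p.imI ^ 2 + p.imJ ^ 2 + p.imK ^ 2) = 1 := by
    rw [← h2]; field_simp
  ext <;> simp [iota]
  · linear_combination -key
  all_goals right; ring

/-- The derivative of `w ↦ r⁻² f` in the coordinates of `ℝ⁴`. -/
def fluxDeriv (f : ℍ[ℝ] → ℍ[ℝ]) (w : Fin 4 → ℝ) : (Fin 4 → ℝ) →L[ℝ] ℍ[ℝ] :=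
  (rr (ofCoords w) ^ 2)⁻¹ • (fderiv ℝ f (ofCoords w)).comp ofCoords +
    ((-2 * (rr (ofCoords w) ^ 4)⁻¹) •
      (w 1 • ContinuousLinearMap.proj (R := ℝ) (φ := fun _ : Fin 4 => ℝ) 1 +
        w 2 • ContinuousLinearMap.proj (R := ℝ) (φ := fun _ : Fin 4 => ℝ) 2 +
        w 3 • ContinuousLinearMap.proj (R := ℝ) (φ := fun _ : Fin 4 => ℝ) 3)).smulRight
      (f (ofCoords w))

theorem hasFDerivAt_flux {f : ℍ[ℝ] → ℍ[ℝ]} {w : Fin 4 → ℝ}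
    (hf : DifferentiableAt ℝ f (ofCoords w)) (hw : qim (ofCoords w) ≠ 0) :
    HasFDerivAt (fun w => (rr (ofCoords w) ^ 2)⁻¹ • f (ofCoords w)) (fluxDeriv f w) w := by
  have hpr (m : Fin 4) : HasFDerivAt (fun w : Fin 4 → ℝ => w m)
      (ContinuousLinearMap.proj (R := ℝ) (φ := fun _ : Fin 4 => ℝ) m) w := hasFDerivAt_apply m w
  have hs := (((hpr 1).pow 2).add ((hpr 2).pow 2)).add ((hpr 3).pow 2)
  have hr (w : Fin 4 → ℝ) : rr (ofCoords w) ^ 2 = w 1 ^ 2 + w 2 ^ 2 + w 3 ^ 2 := rr_sq _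
  have h0 : rr (ofCoords w) ≠ 0 := (rr_pos hw).ne'
  have hs' : HasFDerivAt (fun w : Fin 4 → ℝ => rr (ofCoords w) ^ 2) _ w :=
    hs.congr_of_eventuallyEq (.of_forall hr)
  have hinv := (hasDerivAt_inv (pow_ne_zero 2 h0)).comp_hasFDerivAt w hs'
  refine (hinv.smul (hf.hasFDerivAt.comp w ofCoords.hasFDerivAt)).congr_fderiv ?_
  rw [fluxDeriv]
  congr 2
  ext m
  simp
  ring

theorem divergence_flux {Ω : Set ℍ[ℝ]} {f : ℍ[ℝ] → ℍ[ℝ]} {u v : ℍ[ℝ] → ℝ}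
    (hf : Hyperholo Ω f u v) {w : Fin 4 → ℝ} (hw : ofCoords w ∈ Ω) (hq : qim (ofCoords w) ≠ 0) :
    ∑ m, unit m * fluxDeriv f w (Pi.single m 1) =
      (-2 : ℝ) • (u (ofCoords w) • ((rr (ofCoords w) ^ 3)⁻¹ • iota (ofCoords w))) := by
  have hD := hf.2.2 _ hw
  have hfw := hf.2.1 _ hw
  have h0 : rr (ofCoords w) ≠ 0 := (rr_pos hq).ne'
  have hι := iota_mul_iota hq
  have hi : w 1 • qi + w 2 • qj + w 3 • qk = rr (ofCoords w) • iota (ofCoords w) := by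
    rw [iota, smul_inv_smul₀ h0]
    ext <;> simp [ofCoords_apply]
  have hsplit : ∑ m, unit m * fluxDeriv f w (Pi.single m 1) =
      (rr (ofCoords w) ^ 2)⁻¹ • Dl f (ofCoords w) +
        (-2 * (rr (ofCoords w) ^ 4)⁻¹) • ((w 1 • qi + w 2 • qj + w 3 • qk) * f (ofCoords w)) := by
    simp [Fin.sum_univ_four, fluxDeriv, ofCoords_single, Dl, unit, mul_add, add_mul, smul_smul]
    module
  have hιf : iota (ofCoords w) * f (ofCoords w) =
      u (ofCoords w) • iota (ofCoords w) - v (ofCoords w) • (1 : ℍ[ℝ]) := by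
    rw [hfw, mul_add, ← mul_assoc, hι, Quaternion.mul_coe_eq_smul, neg_one_mul, sub_eq_add_neg,
      ← Quaternion.coe_mul_eq_smul, ← Quaternion.coe_mul_eq_smul, mul_one]
  rw [hsplit, hD, hi, smul_mul_assoc, hιf, ← mul_one ((_ : ℝ) : ℍ[ℝ]),
    Quaternion.coe_mul_eq_smul]
  match_scalars <;> field_simp <;> ring

theorem continuous_rr : Continuous rr := by
  unfold rr
  have h₁ := Quaternion.continuous_imI
  have h₂ := Quaternion.continuous_imJ
  have h₃ := Quaternion.continuous_imK
  fun_prop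

theorem continuousOn_volume_integrand {Ω : Set ℍ[ℝ]} {f : ℍ[ℝ] → ℍ[ℝ]} {u v : ℍ[ℝ] → ℝ}
    (hf : Hyperholo Ω f u v) (hΩ : ∀ p ∈ Ω, qim p ≠ 0) :
    ContinuousOn (fun p => u p • ((rr p ^ 3)⁻¹ • iota p)) Ω := by
  have hr : ContinuousOn rr Ω := continuous_rr.continuousOn
  have hr0 : ∀ p ∈ Ω, rr p ≠ 0 := fun p hp => (rr_pos (hΩ p hp)).ne'
  have hu : ContinuousOn u Ω := by
    have hfc : ContinuousOn f Ω := fun p hp => (hf.1 p hp).continuousAt.continuousWithinAt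
    refine (Quaternion.continuous_re.comp_continuousOn hfc).congr fun p hp => ?_
    simp [hf.2.1 p hp, iota]
  exact hu.smul (((hr.pow 3).inv₀ fun p hp => pow_ne_zero 3 (hr0 p hp)).smul
    ((hr.inv₀ hr0).smul Quaternion.continuous_im.continuousOn))

/-- Cullen's integral theorem for a closed box `B = [a₀,b₀]×[a₁,b₁]×[a₂,b₂]×[a₃,b₃]`
disjoint from the real axis: the outward flux of `p ↦ eₘ · f(p)/r(p)²` through the
boundary of the box equals `-2 ∫_B u·ι/r³`. -/
theorem cullen_integral_box (a₀ b₀ a₁ b₁ a₂ b₂ a₃ b₃ : ℝ)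
    (h₀ : a₀ < b₀) (h₁ : a₁ < b₁) (h₂ : a₂ < b₂) (h₃ : a₃ < b₃)
    (hax : ∀ t ∈ Set.Icc a₀ b₀, ∀ x ∈ Set.Icc a₁ b₁, ∀ y ∈ Set.Icc a₂ b₂,
      ∀ z ∈ Set.Icc a₃ b₃, qim (Q t x y z) ≠ 0)
    (Ω : Set ℍ[ℝ]) (hΩ : IsOpen Ω) (hΩax : ∀ p ∈ Ω, qim p ≠ 0)
    (hBΩ : {p : ℍ[ℝ] | p.re ∈ Set.Icc a₀ b₀ ∧ p.imI ∈ Set.Icc a₁ b₁ ∧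
      p.imJ ∈ Set.Icc a₂ b₂ ∧ p.imK ∈ Set.Icc a₃ b₃} ⊆ Ω)
    (f : ℍ[ℝ] → ℍ[ℝ]) (u v : ℍ[ℝ] → ℝ) (hf : Hyperholo Ω f u v) :
    ((∫ w in Set.Icc a₁ b₁ ×ˢ Set.Icc a₂ b₂ ×ˢ Set.Icc a₃ b₃,
        (1 : ℍ[ℝ]) * f (Q b₀ w.1 w.2.1 w.2.2) / ((rr (Q b₀ w.1 w.2.1 w.2.2) ^ 2 : ℝ) : ℍ[ℝ]))
      - ∫ w in Set.Icc a₁ b₁ ×ˢ Set.Icc a₂ b₂ ×ˢ Set.Icc a₃ b₃,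
        (1 : ℍ[ℝ]) * f (Q a₀ w.1 w.2.1 w.2.2) / ((rr (Q a₀ w.1 w.2.1 w.2.2) ^ 2 : ℝ) : ℍ[ℝ]))
    + ((∫ w in Set.Icc a₀ b₀ ×ˢ Set.Icc a₂ b₂ ×ˢ Set.Icc a₃ b₃,
        qi * f (Q w.1 b₁ w.2.1 w.2.2) / ((rr (Q w.1 b₁ w.2.1 w.2.2) ^ 2 : ℝ) : ℍ[ℝ]))
      - ∫ w in Set.Icc a₀ b₀ ×ˢ Set.Icc a₂ b₂ ×ˢ Set.Icc a₃ b₃,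
        qi * f (Q w.1 a₁ w.2.1 w.2.2) / ((rr (Q w.1 a₁ w.2.1 w.2.2) ^ 2 : ℝ) : ℍ[ℝ]))
    + ((∫ w in Set.Icc a₀ b₀ ×ˢ Set.Icc a₁ b₁ ×ˢ Set.Icc a₃ b₃,
        qj * f (Q w.1 w.2.1 b₂ w.2.2) / ((rr (Q w.1 w.2.1 b₂ w.2.2) ^ 2 : ℝ) : ℍ[ℝ]))
      - ∫ w in Set.Icc a₀ b₀ ×ˢ Set.Icc a₁ b₁ ×ˢ Set.Icc a₃ b₃,
        qj * f (Q w.1 w.2.1 a₂ w.2.2) / ((rr (Q w.1 w.2.1 a₂ w.2.2) ^ 2 : ℝ) : ℍ[ℝ]))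
    + ((∫ w in Set.Icc a₀ b₀ ×ˢ Set.Icc a₁ b₁ ×ˢ Set.Icc a₂ b₂,
        qk * f (Q w.1 w.2.1 w.2.2 b₃) / ((rr (Q w.1 w.2.1 w.2.2 b₃) ^ 2 : ℝ) : ℍ[ℝ]))
      - ∫ w in Set.Icc a₀ b₀ ×ˢ Set.Icc a₁ b₁ ×ˢ Set.Icc a₂ b₂,
        qk * f (Q w.1 w.2.1 w.2.2 a₃) / ((rr (Q w.1 w.2.1 w.2.2 a₃) ^ 2 : ℝ) : ℍ[ℝ]))
    = (-2 : ℝ) • ∫ w in Set.Icc a₀ b₀ ×ˢ Set.Icc a₁ b₁ ×ˢ Set.Icc a₂ b₂ ×ˢ Set.Icc a₃ b₃,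
        u (Q w.1 w.2.1 w.2.2.1 w.2.2.2) •
          ((rr (Q w.1 w.2.1 w.2.2.1 w.2.2.2) ^ 3)⁻¹ • iota (Q w.1 w.2.1 w.2.2.1 w.2.2.2)) := by
  have hQ : ∀ w ∈ Set.Icc ![a₀, a₁, a₂, a₃] ![b₀, b₁, b₂, b₃], ofCoords w ∈ Ω := by
    intro w hw
    apply hBΩ
    simp [Pi.le_def, Fin.forall_fin_succ] at hw
    simp only [ofCoords_apply, Q_re, Q_imI, Q_imJ, Q_imK, Set.mem_ofPred_eq, Set.mem_Icc]
    tauto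
  have hG : ∀ w ∈ Set.Icc ![a₀, a₁, a₂, a₃] ![b₀, b₁, b₂, b₃], ∀ m,
      HasFDerivAt (fun w => unit m * ((rr (ofCoords w) ^ 2)⁻¹ • f (ofCoords w)))
        ((ContinuousLinearMap.mul ℝ ℍ[ℝ] (unit m)).comp (fluxDeriv f w)) w := fun w hw m =>
    (ContinuousLinearMap.mul ℝ ℍ[ℝ] (unit m)).hasFDerivAt.comp w
      (hasFDerivAt_flux (hf.1 _ (hQ w hw)) (hΩax _ (hQ w hw)))
  have hdiv : ∀ w ∈ Set.Icc ![a₀, a₁, a₂, a₃] ![b₀, b₁, b₂, b₃],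
      ∑ m, ((ContinuousLinearMap.mul ℝ ℍ[ℝ] (unit m)).comp (fluxDeriv f w)) (Pi.single m 1) =
        (-2 : ℝ) • (u (ofCoords w) • ((rr (ofCoords w) ^ 3)⁻¹ • iota (ofCoords w))) :=
    fun w hw => divergence_flux hf (hQ w hw) (hΩax _ (hQ w hw))
  have hint : IntegrableOn (fun w => ∑ m,
      ((ContinuousLinearMap.mul ℝ ℍ[ℝ] (unit m)).comp (fluxDeriv f w)) (Pi.single m 1))
      (Set.Icc ![a₀, a₁, a₂, a₃] ![b₀, b₁, b₂, b₃]) := by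
    refine (ContinuousOn.integrableOn_Icc ?_).congr_fun (fun w hw => (hdiv w hw).symm)
      measurableSet_Icc
    exact ((continuousOn_volume_integrand hf hΩax).comp ofCoords.continuous.continuousOn
      hQ).const_smul (-2 : ℝ)
  have hle : ![a₀, a₁, a₂, a₃] ≤ ![b₀, b₁, b₂, b₃] := by
    simp [Pi.le_def, Fin.forall_fin_succ, h₀.le, h₁.le, h₂.le, h₃.le]
  have key := integral_divergence_of_hasFDerivAt_off_countable' _ _ hle
    (fun m w => unit m * ((rr (ofCoords w) ^ 2)⁻¹ • f (ofCoords w)))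
    (fun m w => (ContinuousLinearMap.mul ℝ ℍ[ℝ] (unit m)).comp (fluxDeriv f w)) ∅
    Set.countable_empty (fun m w hw => (hG w hw m).continuousAt.continuousWithinAt)
    (fun w hw m => hG w ⟨fun i => (hw.1 i trivial).1.le, fun i => (hw.1 i trivial).2.le⟩ m) hint
  rw [setIntegral_congr_fun measurableSet_Icc hdiv, integral_smul] at key
  simp only [mul_div_rr_sq]
  have hvol := setIntegral_Icc_fin_four (a₀ := a₀) (a₁ := a₁) (a₂ := a₂) (a₃ := a₃)
    (b₀ := b₀) (b₁ := b₁) (b₂ := b₂) (b₃ := b₃) (fun w => u (Q w.1 w.2.1 w.2.2.1 w.2.2.2) •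
      ((rr (Q w.1 w.2.1 w.2.2.1 w.2.2.2) ^ 3)⁻¹ • iota (Q w.1 w.2.1 w.2.2.1 w.2.2.2)))
  simp only [← ofCoords_apply] at hvol
  rw [hvol, Fin.sum_univ_four] at key
  refine Eq.trans ?_ key.symm
  refine congrArg₂ _ (congrArg₂ _ (congrArg₂ _ ?_ ?_) ?_) ?_
  all_goals
    refine congrArg₂ _ ?_ ?_ <;> symm <;> apply setIntegral_Icc_fin_three <;>
      first | (ext m; fin_cases m <;> rfl) | (intro x; rfl)
end
end
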